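/- arXiv:1811.00836 — 4 statements merged into one kernel-verified Lean document; each statement's English description precedes it below -/
import Mathlib

section
/- Let V be a real vector space, M a positive natural number, ν_1,…,ν_M : V → ℝ linear maps, y ∈ ℝ^M, and λ > 0. Let E : ℝ → ℝ → ℝ be such that for each m the map t ↦ E(t, y_m) is strictly convex, and let R : V → ℝ be convex. Define J(f) = Σ_{m=1}^M E(ν_m(f), y_m) + λ R(f). If f_1 and f_2 are both minimizers of J over V (i.e., J(f_i) ≤ J(g) for all g ∈ V), then ν_m(f_1) = ν_m(f_2) for every m = 1,…,M. -/
/-- **Agreement of minimizers on the sampled values** (Part 2 of the proof of the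
multiple-kernel representer theorem).  If `J(f) = Σ_m E(ν_m f, y_m) + λ R(f)` with each
`t ↦ E(t, y_m)` strictly convex and `R` convex, then any two minimizers of `J` over the
real vector space `V` agree on all the sampled values `ν_m`. -/
theorem minimizers_agree_on_samples
    {V : Type*} [AddCommGroup V] [Module ℝ V]
    {M : ℕ} (hM : 0 < M)
    (ν : Fin M → V →ₗ[ℝ] ℝ) (y : Fin M → ℝ) (lam : ℝ) (hlam : 0 < lam)
    (E : ℝ → ℝ → ℝ)
    (hE : ∀ m : Fin M, StrictConvexOn ℝ Set.univ (fun t => E t (y m)))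
    (R : V → ℝ) (hR : ConvexOn ℝ Set.univ R)
    (J : V → ℝ)
    (hJ : ∀ f : V, J f = (∑ m : Fin M, E (ν m f) (y m)) + lam * R f)
    (f₁ f₂ : V)
    (hf₁ : ∀ g : V, J f₁ ≤ J g) (hf₂ : ∀ g : V, J f₂ ≤ J g) :
    ∀ m : Fin M, ν m f₁ = ν m f₂ := by
  intro k
  by_contra hk
  set g : V := (1 / 2 : ℝ) • f₁ + (1 / 2 : ℝ) • f₂ with hg
  have hνg (m : Fin M) : ν m g = (1 / 2 : ℝ) • ν m f₁ + (1 / 2 : ℝ) • ν m f₂ := by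
    simp only [hg, map_add, map_smul]
  have hRg : R g ≤ (1 / 2 : ℝ) * R f₁ + (1 / 2 : ℝ) * R f₂ :=
    hR.2 (Set.mem_univ f₁) (Set.mem_univ f₂) (by norm_num) (by norm_num) (by norm_num)
  have hsum : ∑ m, E (ν m g) (y m) <
      ∑ m, ((1 / 2 : ℝ) * E (ν m f₁) (y m) + (1 / 2 : ℝ) * E (ν m f₂) (y m)) := by
    refine Finset.sum_lt_sum (fun m _ => ?_) ⟨k, Finset.mem_univ k, ?_⟩
    · rw [hνg]
      exact (hE m).convexOn.2 (Set.mem_univ _) (Set.mem_univ _)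
        (by norm_num) (by norm_num) (by norm_num)
    · rw [hνg]
      exact (hE k).2 (Set.mem_univ _) (Set.mem_univ _) hk
        (by norm_num) (by norm_num) (by norm_num)
  rw [Finset.sum_add_distrib, ← Finset.mul_sum, ← Finset.mul_sum] at hsum
  have hlamR := mul_le_mul_of_nonneg_left hRg hlam.le
  have h₁ := hf₁ g
  have h₂ := hf₂ g
  rw [hJ, hJ g] at h₁ h₂
  linarith
end

section
/- Let V be a real vector space, M a positive natural number, ν_1,…,ν_M : V → ℝ linear maps, y ∈ ℝ^M, and λ > 0. Let E : ℝ → ℝ → ℝ be such that for each m the map t ↦ E(t, y_m) is strictly convex, and let R : V → ℝ be convex. Define J(f) = Σ_{m=1}^M E(ν_m(f), y_m) + λ R(f), and assume the set S of minimizers of J over V is nonempty. Fix f* ∈ S and set z_m = ν_m(f*). Then S = {f ∈ V : ν_m(f) = z_m for all m, and R(f) ≤ R(g) for every g ∈ V with ν_m(g) = z_m for all m}; that is, the solution set of the regularized problem coincides with the solution set of the constrained problem of minimizing R subject to the interpolation constraints ν_m(f) = z_m. -/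
/-- Two minimizers of a penalized functional with strictly convex losses `φ i` and a convex
penalty `P` have the same sampled values. -/
theorem sampled_values_eq_of_forall_le {V ι : Type*} [AddCommGroup V] [Module ℝ V] [Fintype ι]
    {ν : ι → V →ₗ[ℝ] ℝ} {φ : ι → ℝ → ℝ} {P : V → ℝ}
    (hφ : ∀ i, StrictConvexOn ℝ Set.univ (φ i)) (hP : ConvexOn ℝ Set.univ P) {f g : V}
    (hf : ∀ h, ∑ i, φ i (ν i f) + P f ≤ ∑ i, φ i (ν i h) + P h)
    (hg : ∀ h, ∑ i, φ i (ν i g) + P g ≤ ∑ i, φ i (ν i h) + P h) (i : ι) :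
    ν i f = ν i g := by
  by_contra hne
  have hhalf : (0 : ℝ) < 1 / 2 := by norm_num
  have hsum : (1 / 2 : ℝ) + 1 / 2 = 1 := by norm_num
  set h : V := (1 / 2 : ℝ) • f + (1 / 2 : ℝ) • g with hh
  have hνh (j : ι) : ν j h = (1 / 2 : ℝ) • ν j f + (1 / 2 : ℝ) • ν j g := by
    simp only [hh, map_add, map_smul]
  have hloss : ∑ j, φ j (ν j h) < ∑ j, (1 / 2 * φ j (ν j f) + 1 / 2 * φ j (ν j g)) := by
    refine Finset.sum_lt_sum (fun j _ => ?_) ⟨i, Finset.mem_univ i, ?_⟩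
    · rw [hνh]
      exact (hφ j).convexOn.2 (Set.mem_univ _) (Set.mem_univ _) hhalf.le hhalf.le hsum
    · rw [hνh]
      exact (hφ i).2 (Set.mem_univ _) (Set.mem_univ _) hne hhalf hhalf hsum
  have hpen : P h ≤ 1 / 2 * P f + 1 / 2 * P g :=
    hP.2 (Set.mem_univ f) (Set.mem_univ g) hhalf.le hhalf.le hsum
  rw [Finset.sum_add_distrib, ← Finset.mul_sum, ← Finset.mul_sum] at hloss
  linarith [hf h, hg h]

/-- **Equivalence of the penalized and constrained problems** (from the proof of the
multiple-kernel representer theorem).  If the set `S` of minimizers of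
`J(f) = Σ_m E(ν_m f, y_m) + λ R(f)` is nonempty and `f*` is one of them with sampled
values `z_m = ν_m f*`, then `S` coincides with the solution set of the constrained
problem: minimize `R` subject to the interpolation constraints `ν_m f = z_m`. -/
theorem penalized_eq_constrained
    {V : Type*} [AddCommGroup V] [Module ℝ V]
    {M : ℕ} (hM : 0 < M)
    (ν : Fin M → V →ₗ[ℝ] ℝ) (y : Fin M → ℝ) (lam : ℝ) (hlam : 0 < lam)
    (E : ℝ → ℝ → ℝ)
    (hE : ∀ m : Fin M, StrictConvexOn ℝ Set.univ (fun t => E t (y m)))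
    (R : V → ℝ) (hR : ConvexOn ℝ Set.univ R)
    (J : V → ℝ)
    (hJ : ∀ f : V, J f = (∑ m : Fin M, E (ν m f) (y m)) + lam * R f)
    (S : Set V) (hS : S = {f : V | ∀ g : V, J f ≤ J g})
    (fstar : V) (hfstar : fstar ∈ S)
    (z : Fin M → ℝ) (hz : ∀ m : Fin M, z m = ν m fstar) :
    S = {f : V | (∀ m : Fin M, ν m f = z m) ∧
          ∀ g : V, (∀ m : Fin M, ν m g = z m) → R f ≤ R g} := by
  subst hS
  have hle (f : V) (hf : ∀ m, ν m f = z m) (g : V) (hg : ∀ m, ν m g = z m) :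
      J f ≤ J g ↔ R f ≤ R g := by
    simp only [hJ, hf, hg, add_le_add_iff_left, mul_le_mul_iff_right₀ hlam]
  have hmin (f : V) (hf : ∀ g, J f ≤ J g) (h : V) :
      ∑ m, E (ν m f) (y m) + lam * R f ≤ ∑ m, E (ν m h) (y m) + lam * R h := by
    simpa only [hJ] using hf h
  ext f
  constructor
  · intro hf
    have hfz (m : Fin M) : ν m f = z m :=
      (sampled_values_eq_of_forall_le (P := fun v => lam * R v) hE (hR.smul hlam.le)
        (hmin f hf) (hmin fstar hfstar) m).trans (hz m).symm
    exact ⟨hfz, fun g hg => (hle f hfz g hg).1 (hf g)⟩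
  · rintro ⟨hfz, hf⟩ g
    have hsz (m : Fin M) : ν m fstar = z m := (hz m).symm
    exact ((hle f hfz fstar hsz).2 (hf fstar hsz)).trans (hfstar g)
end

section
/- Let M be a positive natural number and let F be a linear map from the real vector space of finite signed Borel measures on ℝ^d to ℝ^M. Let μ be a finite signed Borel measure that minimizes the total-variation norm over the set S = {ν : F(ν) = F(μ)}, and let V = {ν ∈ S : ‖ν‖_TV = ‖μ‖_TV} be the set of all such minimizers. If there exist M+1 pairwise disjoint Borel sets E_1,…,E_{M+1} ⊆ ℝ^d with μ(E_l) ≠ 0 for every l, then μ is not an extreme point of V. -/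
open MeasureTheory

namespace MeasureTheory

namespace VectorMeasure

variable {X V ι : Type*} [MeasurableSpace X] [Fintype ι]

/-- Restriction to a finite disjoint union is the sum of the restrictions. -/
theorem restrict_iUnion_fintype [AddCommMonoid V] [TopologicalSpace V] [ContinuousAdd V]
    [T2Space V] (μ : VectorMeasure X V) {E : ι → Set X} (hE : ∀ i, MeasurableSet (E i))
    (hd : Pairwise (Function.onFun Disjoint E)) :
    μ.restrict (⋃ i, E i) = ∑ i, μ.restrict (E i) := by
  ext A hA
  have h := μ.of_biUnion_finset (s := Finset.univ) (f := fun i ↦ A ∩ E i)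
    (fun i _ j _ hij ↦ (hd hij).mono Set.inter_subset_right Set.inter_subset_right)
    (fun i _ ↦ hA.inter (hE i))
  rw [restrict_apply _ (MeasurableSet.iUnion hE) hA, Set.inter_iUnion]
  simpa [restrict_apply, hE, hA] using h

end VectorMeasure

namespace SignedMeasure

variable {X ι : Type*} [MeasurableSpace X] [Fintype ι]

/-- Adding multiples `a i ≥ -1` of the restrictions of `μ` to disjoint sets `E i` increases the
total variation norm by at most `∑ i, a i * |μ| (E i)`. -/
theorem totalVariation_real_add_sum_smul_restrict_le (μ : SignedMeasure X) {E : ι → Set X}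
    (hE : ∀ i, MeasurableSet (E i)) (hd : Pairwise (Function.onFun Disjoint E))
    {a : ι → ℝ} (ha : ∀ i, 0 ≤ 1 + a i) :
    (μ + ∑ i, a i • μ.restrict (E i)).totalVariation.real Set.univ ≤
      μ.totalVariation.real Set.univ + ∑ i, a i * μ.totalVariation.real (E i) := by
  have hU : MeasurableSet (⋃ i, E i) := MeasurableSet.iUnion hE
  have hdecomp : μ + ∑ i, a i • μ.restrict (E i) =
      μ.restrict (⋃ i, E i)ᶜ + ∑ i, (1 + a i) • μ.restrict (E i) := by
    nth_rw 1 [← μ.restrict_add_restrict_compl hU]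
    simp only [add_smul, one_smul, Finset.sum_add_distrib, μ.restrict_iUnion_fintype hE hd]
    abel
  have hle : (μ + ∑ i, a i • μ.restrict (E i)).totalVariation ≤
      μ.totalVariation.restrict (⋃ i, E i)ᶜ +
        ∑ i, ‖1 + a i‖₊ • μ.totalVariation.restrict (E i) := by
    simp only [hdecomp, totalVariation_eq_variation]
    refine VectorMeasure.variation_add_le.trans (add_le_add ?_ ?_)
    · exact VectorMeasure.variation_restrict_le
    · refine (VectorMeasure.variation_finsetSum_le _ _).trans (Finset.sum_le_sum fun i _ ↦ ?_)
      rw [VectorMeasure.variation_smul, VectorMeasure.variation_restrict (hE i)]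
  calc _ ≤ (μ.totalVariation.restrict (⋃ i, E i)ᶜ +
        ∑ i, ‖1 + a i‖₊ • μ.totalVariation.restrict (E i)).real Set.univ :=
        ENNReal.toReal_mono (measure_ne_top _ _) (hle Set.univ)
    _ = μ.totalVariation.real (⋃ i, E i)ᶜ + ∑ i, (1 + a i) * μ.totalVariation.real (E i) := by
        rw [measureReal_add_apply, measureReal_def (μ := ∑ i, _), Measure.finsetSum_apply,
          ENNReal.toReal_sum (fun i _ ↦ measure_ne_top _ _)]
        simp [measureReal_def, fun i ↦ abs_of_nonneg (ha i)]
    _ = _ := by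
        rw [← measureReal_add_measureReal_compl (μ := μ.totalVariation) hU,
          measureReal_iUnion_fintype hd hE]
        simp only [add_mul, one_mul, Finset.sum_add_distrib]
        ring

end SignedMeasure

end MeasureTheory

/-- **Perturbation argument of the Fisher–Jerome theorem** (scalar form).  If `μ` is a
total-variation-norm minimizer over the fiber `S = {ν : F ν = F μ}` of a linear map `F`
into `ℝ^M`, and `μ` charges `M + 1` pairwise disjoint Borel sets, then `μ` is not an
extreme point of the set `V` of all such minimizers. -/
theorem not_extreme_of_charges_many_sets
    {d M : ℕ} (hM : 0 < M)
    (F : SignedMeasure (EuclideanSpace ℝ (Fin d)) →ₗ[ℝ] EuclideanSpace ℝ (Fin M))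
    (μ : SignedMeasure (EuclideanSpace ℝ (Fin d)))
    (hmin : ∀ ν : SignedMeasure (EuclideanSpace ℝ (Fin d)), F ν = F μ →
      (μ.totalVariation Set.univ).toReal ≤ (ν.totalVariation Set.univ).toReal)
    (V : Set (SignedMeasure (EuclideanSpace ℝ (Fin d))))
    (hV : V = {ν | F ν = F μ ∧
      (ν.totalVariation Set.univ).toReal = (μ.totalVariation Set.univ).toReal})
    (E : Fin (M + 1) → Set (EuclideanSpace ℝ (Fin d)))
    (hEmeas : ∀ l, MeasurableSet (E l))
    (hEdisj : Pairwise (Function.onFun Disjoint E))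
    (hEne : ∀ l, μ (E l) ≠ 0) :
    μ ∉ Set.extremePoints ℝ V := by
  intro hext
  obtain ⟨c, hc, l₀, hl₀⟩ : ∃ c : Fin (M + 1) → ℝ,
      ∑ l, c l • F (μ.restrict (E l)) = 0 ∧ ∃ l, c l ≠ 0 := by
    refine Fintype.not_linearIndependent_iff.1 fun h ↦ ?_
    have := h.fintype_card_le_finrank
    simp at this
  set lam : SignedMeasure (EuclideanSpace ℝ (Fin d)) := ∑ l, c l • μ.restrict (E l) with hlam
  have hFlam : F lam = 0 := by simpa [hlam] using hc
  have hlam_ne : lam ≠ 0 := by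
    intro h0
    have h1 : lam (E l₀) = c l₀ * μ (E l₀) := by
      rw [hlam, _root_.sum_apply, Finset.sum_eq_single l₀]
      · simp [VectorMeasure.restrict_apply, hEmeas]
      · intro l _ hl
        simp [VectorMeasure.restrict_apply, hEmeas, (hEdisj hl.symm).inter_eq]
      · simp
    rw [h0] at h1
    exact mul_ne_zero hl₀ (hEne l₀) (by simpa using h1.symm)
  set ε : ℝ := (1 + ∑ l, |c l|)⁻¹ with hε
  have hden : 0 < 1 + ∑ l, |c l| := by positivity
  have hε_pos : 0 < ε := by positivity
  have hεc : ∀ l, |ε * c l| ≤ 1 := by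
    intro l
    rw [abs_mul, abs_of_pos hε_pos, hε, inv_mul_le_one₀ hden]
    linarith [Finset.single_le_sum (f := fun l ↦ |c l|) (fun _ _ ↦ abs_nonneg _)
      (Finset.mem_univ l)]
  set K : ℝ := ∑ l, c l * μ.totalVariation.real (E l)
  have hF : ∀ t : ℝ, F (μ + t • lam) = F μ := by simp [hFlam]
  have hbound : ∀ t : ℝ, (∀ l, 0 ≤ 1 + t * c l) →
      ((μ + t • lam).totalVariation Set.univ).toReal ≤
        (μ.totalVariation Set.univ).toReal + t * K := by
    intro t ht
    simpa [hlam, K, Finset.smul_sum, smul_smul, Finset.mul_sum, mul_assoc, measureReal_def] using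
      μ.totalVariation_real_add_sum_smul_restrict_le hEmeas hEdisj ht
  have hplus := hbound ε fun l ↦ by linarith [neg_le_of_abs_le (hεc l)]
  have hminus := hbound (-ε) fun l ↦ by linarith [le_of_abs_le (hεc l)]
  have hplus' := hmin _ (hF ε)
  have hminus' := hmin _ (hF (-ε))
  have hmem_plus : μ + ε • lam ∈ V := by
    rw [hV]
    exact ⟨hF ε, by linarith⟩
  have hmem_minus : μ + (-ε) • lam ∈ V := by
    rw [hV]
    exact ⟨hF (-ε), by linarith⟩
  have hseg : μ ∈ openSegment ℝ (μ + ε • lam) (μ + (-ε) • lam) :=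
    ⟨1 / 2, 1 / 2, by norm_num, by norm_num, by norm_num, by module⟩
  have heq := (mem_extremePoints.1 hext).2 _ hmem_plus _ hmem_minus hseg
  exact hlam_ne ((smul_eq_zero.1 (add_eq_left.1 heq.1)).resolve_left hε_pos.ne')
end

section
/- Let μ be a finite signed Borel measure on ℝ^d and M a natural number. If there do not exist M+1 pairwise disjoint Borel sets E_1,…,E_{M+1} ⊆ ℝ^d with μ(E_l) ≠ 0 for every l, then μ is a finite linear combination of at most M Dirac point masses: there exist M₀ ≤ M, distinct points z_1,…,z_{M₀} ∈ ℝ^d and nonzero reals a_1,…,a_{M₀} such that μ = Σ_{l=1}^{M₀} a_l δ_{z_l}, where δ_z is the Dirac measure at z. -/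
open MeasureTheory

namespace MeasureTheory.SignedMeasure

theorem pairwise_disjoint_cons {α : Type*} {n : ℕ} {A : Set α} {E : Fin n → Set α}
    (hA : ∀ i, Disjoint A (E i)) (hE : Pairwise (Function.onFun Disjoint E)) :
    Pairwise (Function.onFun Disjoint (Fin.cons A E : Fin (n + 1) → Set α)) := by
  intro i j hij
  cases i using Fin.cases with
  | zero =>
    cases j using Fin.cases with
    | zero => exact absurd rfl hij
    | succ j => simpa [Function.onFun] using hA j
  | succ i =>
    cases j using Fin.cases with
    | zero => simpa [Function.onFun] using (hA i).symm
    | succ j => simpa [Function.onFun] using hE (fun h => hij (congrArg Fin.succ h))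

variable {α : Type*} [MeasurableSpace α]

/-- If an atomless signed measure charges a set, then it charges two disjoint subsets of it. -/
theorem exists_disjoint_subsets_ne_zero [StandardBorelSpace α] (μ : SignedMeasure α)
    (hμ : ∀ z, μ {z} = 0) {E : Set α} (hE : MeasurableSet E) (hE₀ : μ E ≠ 0) :
    ∃ A B : Set α, A ⊆ E ∧ B ⊆ E ∧ MeasurableSet A ∧ MeasurableSet B ∧ Disjoint A B ∧
      μ A ≠ 0 ∧ μ B ≠ 0 := by
  by_contra! hsplit
  let ν : SignedMeasure α := (μ E)⁻¹ • μ.restrict E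
  have hν_apply {A : Set α} (hA : MeasurableSet A) : ν A = (μ E)⁻¹ * μ (A ∩ E) := by
    simp [ν, VectorMeasure.restrict_apply _ hE hA]
  have hν {A : Set α} (hA : MeasurableSet A) : ν A = 0 ∨ ν A = 1 := by
    rw [hν_apply hA]
    by_cases h : μ (A ∩ E) = 0
    · simp [h]
    · have hdiff : μ (E \ (A ∩ E)) = 0 :=
        hsplit (A ∩ E) (E \ (A ∩ E)) Set.inter_subset_right Set.sdiff_subset (hA.inter hE)
          (hE.diff (hA.inter hE)) Set.disjoint_sdiff_right h
      have hadd := VectorMeasure.of_add_of_sdiff (v := μ) (hA.inter hE) hE Set.inter_subset_right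
      rw [hdiff, add_zero] at hadd
      right
      rw [hadd, inv_mul_cancel₀ hE₀]
  have hpos : 0 ≤[Set.univ] ν := by
    rw [VectorMeasure.le_restrict_univ_iff_le]
    intro A hA
    rcases hν hA with h | h <;> simp [h]
  let m := ν.toMeasureOfZeroLE Set.univ MeasurableSet.univ hpos
  have hm_real {A : Set α} (hA : MeasurableSet A) : m.real A = ν A := by
    simp [m, toMeasureOfZeroLE_real_apply _ hpos MeasurableSet.univ hA]
  have : IsZeroOneMeasure m := by
    refine ⟨fun A hA => ?_⟩
    rw [← measureReal_eq_zero_iff, ← ENNReal.toReal_eq_one_iff, ← measureReal_def, hm_real hA]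
    exact hν hA
  have : NeZero m := by
    refine ⟨fun h => ?_⟩
    have := hm_real hE
    rw [h, hν_apply hE, Set.inter_self, inv_mul_cancel₀ hE₀] at this
    simp at this
  obtain ⟨x, hx⟩ := IsZeroOneMeasure.exists_eq_dirac (μ := m)
  have hx₁ := hm_real (measurableSet_singleton x)
  rw [hν_apply (measurableSet_singleton x), hx] at hx₁
  by_cases hxE : x ∈ E
  · simp [Set.inter_eq_left.mpr (Set.singleton_subset_iff.mpr hxE), hμ, measureReal_def] at hx₁
  · simp [Set.singleton_inter_eq_empty.mpr hxE, measureReal_def] at hx₁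

/-- An atomless signed measure that charges a set charges arbitrarily many pairwise disjoint
subsets of it. -/
theorem exists_pairwise_disjoint_subsets_ne_zero [StandardBorelSpace α] (μ : SignedMeasure α)
    (hμ : ∀ z, μ {z} = 0) (n : ℕ) {E : Set α} (hE : MeasurableSet E) (hE₀ : μ E ≠ 0) :
    ∃ F : Fin n → Set α, (∀ l, F l ⊆ E) ∧ (∀ l, MeasurableSet (F l)) ∧
      Pairwise (Function.onFun Disjoint F) ∧ ∀ l, μ (F l) ≠ 0 := by
  induction n generalizing E with
  | zero => exact ⟨Fin.elim0, fun l => l.elim0, fun l => l.elim0, fun l => l.elim0,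
      fun l => l.elim0⟩
  | succ n ih =>
    obtain ⟨A, B, hAE, hBE, hA, hB, hAB, hA₀, hB₀⟩ :=
      μ.exists_disjoint_subsets_ne_zero hμ hE hE₀
    obtain ⟨F, hFB, hF, hdisj, hF₀⟩ := ih hB hB₀
    refine ⟨Fin.cons A F, Fin.cases hAE fun i => (hFB i).trans hBE, Fin.cases hA hF,
      pairwise_disjoint_cons (fun i => hAB.mono_right (hFB i)) hdisj, Fin.cases hA₀ hF₀⟩

/-- A signed measure on a standard Borel space that cannot charge `M + 1` pairwise disjoint
measurable sets is a combination of at most `M` Dirac masses. -/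
theorem exists_eq_sum_dirac [StandardBorelSpace α] {M : ℕ} (μ : SignedMeasure α)
    (h : ¬ ∃ E : Fin (M + 1) → Set α, (∀ l, MeasurableSet (E l)) ∧
      Pairwise (Function.onFun Disjoint E) ∧ ∀ l, μ (E l) ≠ 0) :
    ∃ (M₀ : ℕ) (_ : M₀ ≤ M) (z : Fin M₀ → α) (a : Fin M₀ → ℝ),
      Function.Injective z ∧ (∀ l, a l ≠ 0) ∧
        μ = ∑ l : Fin M₀, a l • (Measure.dirac (z l)).toSignedMeasure := by
  induction M generalizing μ with
  | zero =>
    have hμ : μ = 0 := by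
      refine VectorMeasure.ext fun A hA => ?_
      by_contra hA₀
      exact h ⟨fun _ => A, fun _ => hA, fun i j hij => absurd (Fin.ext (by lia)) hij,
        fun _ => hA₀⟩
    exact ⟨0, le_rfl, Fin.elim0, Fin.elim0, fun i => i.elim0, fun i => i.elim0, by simp [hμ]⟩
  | succ M ih =>
    by_cases hμ : μ = 0
    · exact ⟨0, Nat.zero_le _, Fin.elim0, Fin.elim0, fun i => i.elim0, fun i => i.elim0,
        by simp [hμ]⟩
    obtain ⟨E, hE, hE₀⟩ : ∃ E, MeasurableSet E ∧ μ E ≠ 0 := by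
      by_contra! hzero
      exact hμ (VectorMeasure.ext fun A hA => by simpa using hzero A hA)
    obtain ⟨x, hx⟩ : ∃ x, μ {x} ≠ 0 := by
      by_contra! hatom
      obtain ⟨F, -, hF⟩ := μ.exists_pairwise_disjoint_subsets_ne_zero hatom (M + 1 + 1) hE hE₀
      exact h ⟨F, hF⟩
    have hxm : MeasurableSet {x} := measurableSet_singleton x
    obtain ⟨M₀, hM₀, z, a, hz, ha, hsum⟩ := ih (μ.restrict {x}ᶜ) <| by
      rintro ⟨F, hF, hdisj, hF₀⟩
      refine h ⟨Fin.cons {x} fun i => F i ∩ {x}ᶜ,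
        Fin.cases hxm fun i => (hF i).inter hxm.compl,
        pairwise_disjoint_cons (fun i => ?_) fun i j hij => ?_, Fin.cases hx fun i => ?_⟩
      · exact disjoint_compl_right.mono_right Set.inter_subset_right
      · exact (hdisj hij).mono Set.inter_subset_left Set.inter_subset_left
      · simpa [VectorMeasure.restrict_apply _ hxm.compl (hF i)] using hF₀ i
    have hzx (i : Fin M₀) : z i ≠ x := by
      rintro rfl
      have hzero : μ.restrict {z i}ᶜ {z i} = 0 := by
        simp [VectorMeasure.restrict_apply _ hxm.compl hxm]
      have hval : (∑ l, a l • (Measure.dirac (z l)).toSignedMeasure) {z i} = a i := by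
        rw [FunLike.coe_sum, Finset.sum_apply, Finset.sum_eq_single i]
        · simp [measureReal_def]
        · intro j _ hji
          simp [measureReal_def, hz.ne hji]
        · simp
      rw [hsum, hval] at hzero
      exact ha i hzero
    refine ⟨M₀ + 1, Nat.succ_le_succ hM₀, Fin.cons x z, Fin.cons (μ {x}) a,
      Fin.cons_injective_iff.mpr ⟨?_, hz⟩, Fin.cases hx ha, ?_⟩
    · rintro ⟨i, hi⟩
      exact hzx i hi
    · rw [Fin.sum_univ_succ]
      simp only [Fin.cons_zero, Fin.cons_succ]
      rw [← hsum]
      conv_lhs => rw [← VectorMeasure.restrict_add_restrict_compl (v := μ) hxm]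
      congr 1
      ext A hA
      by_cases hxA : x ∈ A <;> simp [hA, hxA, measureReal_def]

end MeasureTheory.SignedMeasure


/-- A finite signed Borel measure on `ℝ^d` that cannot charge `M + 1` pairwise disjoint
Borel sets is a finite linear combination of at most `M` Dirac point masses at distinct
points, with nonzero weights. -/
theorem signedMeasure_eq_sum_dirac_of_not_charges_many_sets
    {d M : ℕ}
    (μ : SignedMeasure (EuclideanSpace ℝ (Fin d)))
    (h : ¬ ∃ E : Fin (M + 1) → Set (EuclideanSpace ℝ (Fin d)),
        (∀ l, MeasurableSet (E l)) ∧ Pairwise (Function.onFun Disjoint E) ∧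
          ∀ l, μ (E l) ≠ 0) :
    ∃ (M₀ : ℕ) (_ : M₀ ≤ M) (z : Fin M₀ → EuclideanSpace ℝ (Fin d))
      (a : Fin M₀ → ℝ),
      Function.Injective z ∧ (∀ l, a l ≠ 0) ∧
        μ = ∑ l : Fin M₀, a l • (Measure.dirac (z l)).toSignedMeasure := by
  exact μ.exists_eq_sum_dirac h
end
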